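/- Let G be a simple connected graph on n ≥ 3 vertices with edge connectivity κ′(G) ≤ k for some k ≥ 1. Then SO(G) ≥ 2√2·(n−3) + 2√5, with equality if and only if G ≅ P_n. -/

import Mathlib

/-- The Sombor index of a finite simple graph:
`SO(G) = Σ_{uv ∈ E(G)} √(d(u)² + d(v)²)`. -/
noncomputable def somborIndex {V : Type*} [Fintype V] (G : SimpleGraph V) : ℝ := by
  classical
  exact ∑ e ∈ G.edgeFinset,
    Sym2.lift ⟨fun u v => Real.sqrt ((G.degree u : ℝ)^2 + (G.degree v : ℝ)^2),
      fun u v => by simp [add_comm]⟩ e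

/-- The vertex connectivity of `G` is at most `k`: either `G` has at most `k+1`
vertices, or some set of at most `k` vertices disconnects `G`. -/
def vertexConnAtMost {V : Type*} [Fintype V] (G : SimpleGraph V) (k : ℕ) : Prop :=
  Fintype.card V ≤ k + 1 ∨
    ∃ S : Finset V, S.card ≤ k ∧ ¬ (G.induce ((↑S : Set V)ᶜ)).Connected

/-- The edge connectivity of `G` is at most `k`: some set of at most `k` edges
of `G` disconnects `G`. -/
def edgeConnAtMost {V : Type*} [Fintype V] (G : SimpleGraph V) (k : ℕ) : Prop :=
  ∃ F : Set (Sym2 V), F ⊆ G.edgeSet ∧ Nat.card F ≤ k ∧ ¬ (G.deleteEdges F).Connected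

open SimpleGraph

/-- Double counting: summing a vertex function over edge endpoints. -/
lemma sombor_sum_edges {V : Type*} [Fintype V] [DecidableEq V] (G : SimpleGraph V)
    [DecidableRel G.Adj] (φ : V → ℝ) :
    ∑ e ∈ G.edgeFinset, Sym2.lift ⟨fun u v => φ u + φ v, fun u v => add_comm _ _⟩ e
      = ∑ v, (G.degree v : ℝ) * φ v := by
  have h1 : ∑ d : G.Dart, φ d.fst = ∑ v, (G.degree v : ℝ) * φ v := by
    rw [← Finset.sum_fiberwise (s := Finset.univ) (g := fun d : G.Dart => d.fst)]
    refine Finset.sum_congr rfl fun v _ => ?_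
    rw [← G.dart_fst_fiber_card_eq_degree v, ← nsmul_eq_mul, ← Finset.sum_const]
    refine Finset.sum_congr rfl fun d hd => ?_
    rw [(Finset.mem_filter.1 hd).2]
  rw [← h1, ← Finset.sum_fiberwise_of_maps_to (s := Finset.univ) (t := G.edgeFinset)
    (g := fun d : G.Dart => d.edge) (by intro d _; rw [mem_edgeFinset]; exact d.edge_mem)]
  refine Finset.sum_congr rfl fun e he => ?_
  induction e with
  | _ u v =>
    rw [mem_edgeFinset, mem_edgeSet] at he
    let d : G.Dart := ⟨(u, v), he⟩
    have hd : (Finset.univ.filter fun d' : G.Dart => d'.edge = s(u, v)) = {d, d.symm} :=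
      d.edge_fiber
    rw [hd, Finset.sum_pair d.symm_ne.symm]
    rfl

/-- The key edge inequality, with its equality cases. -/
lemma sombor_edge (a b : ℕ) (ha : 1 ≤ a) (hb : 1 ≤ b) (hab : ¬ (a = 1 ∧ b = 1)) :
    (2 * (3 * √2 - √5) - (4 * √2 - 2 * √5) * ((a : ℝ)⁻¹ + (b : ℝ)⁻¹)
        ≤ √((a : ℝ)^2 + (b : ℝ)^2)) ∧
    (2 * (3 * √2 - √5) - (4 * √2 - 2 * √5) * ((a : ℝ)⁻¹ + (b : ℝ)⁻¹)
        = √((a : ℝ)^2 + (b : ℝ)^2) ↔ a ≤ 2 ∧ b ≤ 2) := by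
  have l2 : 1.414 < √2 := Real.lt_sqrt_of_sq_lt (by norm_num)
  have u2 : √2 < 1.415 := (Real.sqrt_lt' (by norm_num)).2 (by norm_num)
  have l5 : 2.236 < √5 := Real.lt_sqrt_of_sq_lt (by norm_num)
  have u5 : √5 < 2.237 := (Real.sqrt_lt' (by norm_num)).2 (by norm_num)
  have l10 : 3.1 < √10 := Real.lt_sqrt_of_sq_lt (by norm_num)
  have l13 : 3.6 < √13 := Real.lt_sqrt_of_sq_lt (by norm_num)
  have l18 : 4.2 < √18 := Real.lt_sqrt_of_sq_lt (by norm_num)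
  have e8 : √8 = 2 * √2 := by
    rw [show (8 : ℝ) = 2 ^ 2 * 2 by norm_num, Real.sqrt_mul (by norm_num),
      Real.sqrt_sq (by norm_num)]
  by_cases hbig : 17 ≤ a ^ 2 + b ^ 2
  · have h17 : (4.1 : ℝ) < √((a : ℝ)^2 + (b : ℝ)^2) := by
      apply Real.lt_sqrt_of_sq_lt
      have : (17 : ℝ) ≤ (a : ℝ)^2 + (b : ℝ)^2 := by exact_mod_cast hbig
      norm_num
      linarith
    have hpos : 0 ≤ (4 * √2 - 2 * √5) * ((a : ℝ)⁻¹ + (b : ℝ)⁻¹) := by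
      apply mul_nonneg
      · linarith
      · positivity
    have hlt : 2 * (3 * √2 - √5) - (4 * √2 - 2 * √5) * ((a : ℝ)⁻¹ + (b : ℝ)⁻¹)
        < √((a : ℝ)^2 + (b : ℝ)^2) := by linarith
    refine ⟨hlt.le, fun h => absurd h hlt.ne, fun h => ?_⟩
    exfalso
    nlinarith [h.1, h.2]
  · have ha4 : a < 4 ∨ 4 ≤ a := lt_or_ge _ _
    have ha' : a < 5 := by nlinarith
    have hb' : b < 5 := by nlinarith
    interval_cases a <;> interval_cases b <;> first
      | (exfalso; simp at hab; done)
      | (exfalso; simp at hbig; done)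
      | (norm_num [e8]; done)
      | (norm_num [e8]
         constructor
         · linarith
         · intro h; linarith)
      | (norm_num [e8]
         constructor <;> linarith)
      | (norm_num [e8]
         linarith)

/-- A connected graph with maximum degree at most two and `n - 1` edges is a path. -/
lemma sombor_path {V : Type*} [Fintype V] [DecidableEq V] (G : SimpleGraph V)
    [DecidableRel G.Adj] (hG : G.Connected) (hm : G.edgeFinset.card + 1 = Fintype.card V)
    (hd : ∀ v, G.degree v ≤ 2) : Nonempty (G ≃g pathGraph (Fintype.card V)) := by
  have := hG.nonempty
  obtain ⟨u, v, p, hp, hmax⟩ := Walk.exists_isPath_forall_isPath_length_le_length G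
  have hclosed : ∀ x y, x ∈ p.support → G.Adj x y → y ∈ p.support := by
    intro x y hx hxy
    by_contra hy
    obtain ⟨i, rfl, hi⟩ := Walk.mem_support_iff_exists_getVert.1 hx
    rcases Nat.eq_zero_or_pos i with h0 | h0
    · subst h0
      rw [Walk.getVert_zero] at hxy
      have := hmax _ _ (Walk.cons hxy.symm p) (by rw [Walk.cons_isPath_iff]; exact ⟨hp, hy⟩)
      simp at this
    rcases hi.eq_or_lt with h1 | h1
    · subst h1
      rw [Walk.getVert_length] at hxy
      have := hmax _ _ (Walk.cons hxy.symm p.reverse)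
        (by rw [Walk.cons_isPath_iff]; exact ⟨hp.reverse, by simpa using hy⟩)
      simp at this
    · have a1 := p.adj_getVert_succ h1
      have a0 := p.adj_getVert_succ (i := i - 1) (by omega)
      rw [Nat.sub_add_cancel h0] at a0
      have hne : p.getVert (i - 1) ≠ p.getVert (i + 1) := by
        intro h
        have := hp.getVert_injOn (by simp; omega) (by simp; omega) h
        omega
      have hn1 : y ≠ p.getVert (i - 1) := fun h => hy (h ▸ p.getVert_mem_support _)
      have hn2 : y ≠ p.getVert (i + 1) := fun h => hy (h ▸ p.getVert_mem_support _)
      have hsub : ({y, p.getVert (i - 1), p.getVert (i + 1)} : Finset V)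
          ⊆ G.neighborFinset (p.getVert i) := by
        intro z hz
        simp only [Finset.mem_insert, Finset.mem_singleton] at hz
        rw [mem_neighborFinset]
        rcases hz with rfl | rfl | rfl
        · exact hxy
        · exact a0.symm
        · exact a1
      have hc := Finset.card_le_card hsub
      rw [Finset.card_eq_three.2 ⟨_, _, _, hn1, hn2, hne, rfl⟩, card_neighborFinset_eq_degree] at hc
      have := hd (p.getVert i)
      omega
  have hall : ∀ x, x ∈ p.support := by
    intro x
    obtain ⟨q⟩ := hG.preconnected u x
    have key : ∀ (a b : V) (q : G.Walk a b), a ∈ p.support → b ∈ p.support := by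
      intro a b q
      induction q with
      | nil => exact id
      | cons h _ ih => exact fun ha => ih (hclosed _ _ ha h)
    exact key _ _ q p.start_mem_support
  have hlen : Fintype.card V = p.length + 1 := by
    rw [← p.length_support, ← List.toFinset_card_of_nodup hp.support_nodup, ← Finset.card_univ]
    congr 1
    ext x
    simp [hall x]
  obtain ⟨c⟩ := hp.isContained_pathGraph
  rw [hlen] at hm ⊢
  have hbij : Function.Bijective c :=
    (Fintype.bijective_iff_injective_and_card c).2 ⟨c.injective, by simp [hlen]⟩
  let e : Fin (p.length + 1) ≃ V := Equiv.ofBijective c hbij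
  let H := (pathGraph (p.length + 1)).map e.toEmbedding
  have hle : H ≤ G := by
    rw [SimpleGraph.map_le_iff_le_comap]
    intro a b h
    exact c.toHom.map_rel h
  classical
  have iso : pathGraph (p.length + 1) ≃g H := Iso.map e _
  have hHc : H.Connected := iso.connected_iff.1 (pathGraph_connected _)
  have hHcard := hHc.card_vert_le_card_edgeSet_add_one
  rw [Nat.card_eq_fintype_card, Nat.card_eq_fintype_card, hlen, ← edgeFinset_card] at hHcard
  have heq : H.edgeFinset = G.edgeFinset :=
    Finset.eq_of_subset_of_card_le (edgeFinset_mono hle) (by omega)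
  have hGH : H = G := edgeFinset_inj.1 heq
  have hgen : ∀ (m : ℕ) (H' G' : SimpleGraph V), H' = G' → (pathGraph m ≃g H') →
      Nonempty (G' ≃g pathGraph m) := by
    rintro m H' G' rfl i
    exact ⟨i.symm⟩
  exact hgen _ _ _ hGH iso

lemma sombor_path_conv {V : Type*} [Fintype V] [DecidableEq V] (G : SimpleGraph V)
    [DecidableRel G.Adj] (n : ℕ) (f : G ≃g pathGraph (n + 1)) :
    G.edgeFinset.card ≤ n ∧ ∀ v, G.degree v ≤ 2 := by
  classical
  constructor
  · rw [f.card_edgeFinset_eq]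
    have : (pathGraph (n + 1)).edgeFinset ⊆
        (Finset.univ : Finset (Fin n)).image (fun i => s(i.castSucc, i.succ)) := by
      intro e he
      induction e with
      | _ a b =>
        rw [mem_edgeFinset, mem_edgeSet, pathGraph_adj] at he
        rw [Finset.mem_image]
        rcases he with h | h
        · refine ⟨⟨a, by omega⟩, Finset.mem_univ _, ?_⟩
          rw [Sym2.eq_iff]
          left
          constructor <;> ext <;> simp [h]
        · refine ⟨⟨b, by omega⟩, Finset.mem_univ _, ?_⟩
          rw [Sym2.eq_iff]
          right
          constructor <;> ext <;> simp [h]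
    refine (Finset.card_le_card this).trans (Finset.card_image_le.trans (by simp))
  · intro v
    rw [← f.degree_eq v, ← card_neighborFinset_eq_degree]
    have : ((pathGraph (n + 1)).neighborFinset (f v)).image Fin.val ⊆
        {(f v).val + 1, (f v).val - 1} := by
      intro x hx
      simp only [Finset.mem_image, mem_neighborFinset, pathGraph_adj] at hx
      simp only [Finset.mem_insert, Finset.mem_singleton]
      obtain ⟨a, h, rfl⟩ := hx
      omega
    have h2 := Finset.card_le_card this
    rw [Finset.card_image_of_injective _ Fin.val_injective] at h2
    exact h2.trans Finset.card_le_two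

/-- Lower bound for the Sombor index of connected graphs on n ≥ 3 vertices with
edge connectivity at most k, with equality iff G ≅ Pₙ. -/
theorem somborIndex_ge_of_edgeConnAtMost {V : Type*} [Fintype V] (G : SimpleGraph V)
    (hG : G.Connected) (n k : ℕ) (hcard : Fintype.card V = n)
    (hn : 3 ≤ n) (hk : 1 ≤ k) (hconn : edgeConnAtMost G k) :
    2 * Real.sqrt 2 * ((n : ℝ) - 3) + 2 * Real.sqrt 5 ≤ somborIndex G ∧
      (somborIndex G = 2 * Real.sqrt 2 * ((n : ℝ) - 3) + 2 * Real.sqrt 5 ↔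
        Nonempty (G ≃g SimpleGraph.pathGraph n)) := by
  classical
  subst hcard
  have hnt : Nontrivial V := Fintype.one_lt_card_iff_nontrivial.1 (by omega)
  have hdeg : ∀ v, 1 ≤ G.degree v := fun v => hG.preconnected.degree_pos_of_nontrivial v
  have l2 : 1.414 < √2 := Real.lt_sqrt_of_sq_lt (by norm_num)
  have u5 : √5 < 2.237 := (Real.sqrt_lt' (by norm_num)).2 (by norm_num)
  -- no edge joins two leaves
  have hno : ∀ u v, G.Adj u v → ¬ (G.degree u = 1 ∧ G.degree v = 1) := by
    rintro u v huv ⟨hu, hv⟩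
    have key : ∀ (a b : V) (q : G.Walk a b), (a = u ∨ a = v) → (b = u ∨ b = v) := by
      intro a b q
      induction q with
      | nil => exact id
      | cons h _ ih =>
        intro ha
        apply ih
        rcases ha with rfl | rfl
        · right
          exact (degree_eq_one_iff_existsUnique_adj.1 hu).unique h huv
        · left
          exact (degree_eq_one_iff_existsUnique_adj.1 hv).unique h huv.symm
    have hsub : (Finset.univ : Finset V) ⊆ {u, v} := by
      intro x _
      obtain ⟨q⟩ := hG.preconnected u x
      simpa using key _ _ q (Or.inl rfl)
    have := (Finset.card_le_card hsub).trans Finset.card_le_two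
    rw [Finset.card_univ] at this
    omega
  let F : Sym2 V → ℝ := Sym2.lift ⟨fun u v => √((G.degree u : ℝ)^2 + (G.degree v : ℝ)^2),
      fun u v => by simp [add_comm]⟩
  let I : Sym2 V → ℝ := Sym2.lift ⟨fun u v => (G.degree u : ℝ)⁻¹ + (G.degree v : ℝ)⁻¹,
      fun u v => add_comm _ _⟩
  have hSO : somborIndex G = ∑ e ∈ G.edgeFinset, F e := by
    unfold somborIndex
    rfl
  have hI : ∑ e ∈ G.edgeFinset, I e = (Fintype.card V : ℝ) := by
    have h := sombor_sum_edges G (fun v => (G.degree v : ℝ)⁻¹)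
    rw [show ∑ e ∈ G.edgeFinset, I e = _ from h, ← Finset.card_univ, Finset.cast_card]
    refine Finset.sum_congr rfl fun v _ => ?_
    have := hdeg v
    exact mul_inv_cancel₀ (by positivity)
  let L : Sym2 V → ℝ := fun e => 2 * (3 * √2 - √5) - (4 * √2 - 2 * √5) * I e
  have hL : ∑ e ∈ G.edgeFinset, L e = 2 * (3 * √2 - √5) * (G.edgeFinset.card : ℝ)
      - (4 * √2 - 2 * √5) * (Fintype.card V : ℝ) := by
    simp only [L]
    rw [Finset.sum_sub_distrib, Finset.sum_const, ← Finset.mul_sum, hI, nsmul_eq_mul]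
    ring
  have hLF : ∀ e ∈ G.edgeFinset, L e ≤ F e := by
    intro e he
    induction e with
    | _ u v =>
      rw [mem_edgeFinset, mem_edgeSet] at he
      exact (sombor_edge _ _ (hdeg u) (hdeg v) (hno u v he)).1
  have hLFeq : ∀ u v, G.Adj u v → (L s(u, v) = F s(u, v) ↔ G.degree u ≤ 2 ∧ G.degree v ≤ 2) :=
    fun u v h => (sombor_edge _ _ (hdeg u) (hdeg v) (hno u v h)).2
  have hsum := Finset.sum_le_sum hLF
  have hm := hG.card_vert_le_card_edgeSet_add_one
  rw [Nat.card_eq_fintype_card, Nat.card_eq_fintype_card, ← edgeFinset_card] at hm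
  have hmR : (Fintype.card V : ℝ) ≤ (G.edgeFinset.card : ℝ) + 1 := by exact_mod_cast hm
  have hc : 0 < 2 * (3 * √2 - √5) := by linarith
  have hstep : 2 * √2 * ((Fintype.card V : ℝ) - 3) + 2 * √5 ≤ ∑ e ∈ G.edgeFinset, L e := by
    rw [hL]
    nlinarith [mul_le_mul_of_nonneg_left hmR hc.le]
  rw [hSO]
  refine ⟨hstep.trans hsum, fun h => ?_, ?_⟩
  · have h1 : ∑ e ∈ G.edgeFinset, L e = ∑ e ∈ G.edgeFinset, F e :=
      le_antisymm hsum (h ▸ hstep)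
    have h2 := (Finset.sum_eq_sum_iff_of_le hLF).1 h1
    apply sombor_path G hG
    · have h3 : 2 * (3 * √2 - √5) * ((G.edgeFinset.card : ℝ) + 1 - Fintype.card V) = 0 := by
        rw [← h1, hL] at h
        linarith
      have h4 := (mul_eq_zero.1 h3).resolve_left hc.ne'
      have h5 : (G.edgeFinset.card : ℝ) + 1 = Fintype.card V := by linarith
      exact_mod_cast h5
    · intro u
      obtain ⟨v, huv⟩ := (G.degree_pos_iff_exists_adj u).1 (hdeg u)
      exact ((hLFeq u v huv).1 (h2 _ (by simpa using huv))).1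
  · rintro ⟨f⟩
    obtain ⟨m, hm'⟩ : ∃ m, Fintype.card V = m + 1 := ⟨Fintype.card V - 1, by omega⟩
    obtain ⟨h1, h2⟩ := sombor_path_conv G m (hm' ▸ f)
    have h3 : ∑ e ∈ G.edgeFinset, L e = ∑ e ∈ G.edgeFinset, F e := by
      refine Finset.sum_congr rfl fun e he => ?_
      induction e with
      | _ u v =>
        rw [mem_edgeFinset, mem_edgeSet] at he
        exact (hLFeq u v he).2 ⟨h2 u, h2 v⟩
    have h4 : (G.edgeFinset.card : ℝ) = Fintype.card V - 1 := by
      have : G.edgeFinset.card + 1 = Fintype.card V := by omega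
      rw [← this]; push_cast; ring
    rw [← h3, hL, h4]
    ring
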